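/- For l ≥ 5 and any prime power q, there exists a symmetric generating set T of SL(l+1,q) with |T| ≤ 6 and a subset S of vertices of Cay(SL(l+1,q), T) with |S| ≤ |SL(l+1,q)|/2 such that |∂S|/|S| ≤ 6/l. Consequently the isoperimetric number h(Cay(SL(l+1,q),T)) ≤ 6/l. -/

import Mathlib

open Matrix Matrix.SpecialLinearGroup

/-- Induction on `Fin (l + 1)` along the cyclic successor. -/
@[elab_as_elim]
lemma fin_cyclic_induction {l : ℕ} {P : Fin (l + 1) → Prop} {i₀ : Fin (l + 1)} (base : P i₀)
    (step : ∀ i, P i → P (i + 1)) (i : Fin (l + 1)) : P i := by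
  have h0 : P 0 := by
    induction i₀ using Fin.reverseInduction with
    | last => simpa using step _ base
    | cast i ih => exact ih (by simpa using step _ base)
  induction i using Fin.induction with
  | zero => exact h0
  | succ i ih => simpa using step _ ih

section Generation

variable {ι K : Type*} [Fintype ι] [DecidableEq ι] [Field K]

/-- Commutator relation: `T_{ij}(a)` and `T_{jk}(b)` generate `T_{ik}(ab)`. -/
lemma transvection_mul_mem {H : Subgroup (SpecialLinearGroup ι K)} {i j k : ι}
    (hij : i ≠ j) (hjk : j ≠ k) (hik : i ≠ k) {a b : K}
    (ha : SpecialLinearGroup.transvection hij a ∈ H)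
    (hb : SpecialLinearGroup.transvection hjk b ∈ H) :
    SpecialLinearGroup.transvection hik (a * b) ∈ H := by
  have key : SpecialLinearGroup.transvection hij a * SpecialLinearGroup.transvection hjk b =
      SpecialLinearGroup.transvection hik (a * b) *
        (SpecialLinearGroup.transvection hjk b * SpecialLinearGroup.transvection hij a) := by
    apply Subtype.ext
    simp only [coe_mul, transvection_coe, mul_add, add_mul, one_mul, mul_one,
      single_mul_single_same, single_mul_single_of_ne _ _ _ _ hjk.symm,
      single_mul_single_of_ne _ _ _ _ hik.symm, add_zero]
    abel
  rw [← mul_inv_eq_iff_eq_mul] at key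
  rw [← key]
  exact H.mul_mem (H.mul_mem ha hb) (H.inv_mem (H.mul_mem hb ha))

lemma diag2n_eq_prod_transvection {i j : ι} (hij : i ≠ j) (a : K) (ha : a ≠ 0) :
    diag2n hij a ha = SpecialLinearGroup.transvection hij a *
      SpecialLinearGroup.transvection hij.symm (-a⁻¹) *
      SpecialLinearGroup.transvection hij a *
      SpecialLinearGroup.transvection hij (-1) *
      SpecialLinearGroup.transvection hij.symm 1 *
      SpecialLinearGroup.transvection hij (-1) := by
  apply Subtype.ext
  simp only [coe_mul, transvection_coe, mul_add, add_mul, one_mul, mul_one,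
    single_mul_single_same, single_mul_single_of_ne _ _ _ _ hij.symm,
    single_mul_single_of_ne _ _ _ _ hij, diag2n_coe, add_zero]
  ext x y
  simp only [Matrix.add_apply, Matrix.single_apply, Matrix.one_apply, Matrix.diagonal_apply]
  by_cases hxi : x = i <;> by_cases hxj : x = j <;> by_cases hyi : y = i <;>
    by_cases hyj : y = j <;> grind

lemma eq_top_of_transvection_mem [Nontrivial ι] {H : Subgroup (SpecialLinearGroup ι K)}
    (h : ∀ (i j : ι) (hij : i ≠ j) (a : K), SpecialLinearGroup.transvection hij a ∈ H) :
    H = ⊤ := by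
  refine eq_top_iff.2 fun M _ ↦ diagonal_transvection_induction' (· ∈ H) M ?_ h
    fun _ _ ↦ H.mul_mem
  intro i j hij c hc
  rw [diag2n_eq_prod_transvection]
  repeat' first | apply H.mul_mem | apply h

lemma eq_top_of_cyclic_transvection_mem {l : ℕ} (hl : 2 ≤ l) {g : K}
    (hg : ∀ x : K, x ≠ 0 → ∃ k : ℕ, g ^ k = x)
    {H : Subgroup (SpecialLinearGroup (Fin (l + 1)) K)}
    (h1 : ∀ (i : Fin (l + 1)) (h : i ≠ i + 1), SpecialLinearGroup.transvection h (1 : K) ∈ H)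
    (h2 : ∀ (i : Fin (l + 1)) (h : i ≠ i + 1), SpecialLinearGroup.transvection h g ∈ H) :
    H = ⊤ := by
  have : Nontrivial (Fin (l + 1)) := Fin.nontrivial_iff_two_le.2 (by omega)
  have hsucc (i : Fin (l + 1)) : i ≠ i + 1 := by
    simpa using (by omega : l ≠ 0)
  have hone (i j : Fin (l + 1)) : ∀ h : i ≠ j, SpecialLinearGroup.transvection h (1 : K) ∈ H := by
    induction j using fin_cyclic_induction (i₀ := i) with
    | base => exact fun h ↦ absurd rfl h
    | step j ih =>
      intro h
      rcases eq_or_ne i j with rfl | hk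
      · exact h1 i h
      · simpa using transvection_mul_mem hk (hsucc _) h (ih hk) (h1 _ (hsucc _))
  have exists_third (i j : Fin (l + 1)) : ∃ m, m ≠ i ∧ m ≠ j := by
    obtain ⟨m, hm⟩ := Finset.exists_mem_notMem_of_card_lt_card (s := {i, j}) (t := Finset.univ)
      (Finset.card_le_two.trans_lt (by simp; omega))
    exact ⟨m, by simpa using hm⟩
  have hgen (i j : Fin (l + 1)) (h : i ≠ j) : SpecialLinearGroup.transvection h g ∈ H := by
    by_cases hj : j = i + 1
    · subst hj; exact h2 i h
    · simpa using transvection_mul_mem (hsucc i) (Ne.symm hj) h (h2 i (hsucc i))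
        (hone _ _ (Ne.symm hj))
  have hpow (k : ℕ) : ∀ (i j : Fin (l + 1)) (h : i ≠ j),
      SpecialLinearGroup.transvection h (g ^ k) ∈ H := by
    induction k with
    | zero => simpa using hone
    | succ k ih =>
      intro i j h
      obtain ⟨m, hmi, hmj⟩ := exists_third i j
      rw [pow_succ]
      exact transvection_mul_mem hmi.symm hmj h (ih _ _ _) (hgen _ _ _)
  refine eq_top_of_transvection_mem fun i j hij a ↦ ?_
  rcases eq_or_ne a 0 with rfl | ha
  · simp
  · obtain ⟨k, rfl⟩ := hg a ha
    exact hpow k i j hij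

end Generation

section SignedShift

variable (l : ℕ) (K : Type*) [Field K]

/-- The signs making the cyclic permutation matrix of size `l + 1` unimodular. -/
def shiftSign (i : Fin (l + 1)) : K := if i = Fin.last l then (-1) ^ l else 1

/-- The signed cyclic shift, sending the row vector `e_i` to `e_{i+1}` for `i < l` and
`e_l` to `(-1)^l e_0`. -/
def signedShift : SpecialLinearGroup (Fin (l + 1)) K :=
  ⟨diagonal (shiftSign l K) * (finRotate (l + 1)).permMatrix K, by
    rw [det_mul, det_diagonal, det_permutation, sign_finRotate]
    simp [shiftSign, ← mul_pow]⟩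

variable {l K}

lemma signedShift_apply (i j : Fin (l + 1)) :
    (signedShift l K).1 i j = if j = i + 1 then shiftSign l K i else 0 := by
  simp [signedShift, PEquiv.toMatrix_apply, eq_comm]

lemma shiftSign_mul_self (i : Fin (l + 1)) : shiftSign l K i * shiftSign l K i = 1 := by
  unfold shiftSign; split_ifs <;> simp [← mul_pow]

lemma shiftSign_eq_or (i : Fin (l + 1)) : shiftSign l K i = 1 ∨ shiftSign l K i = -1 :=
  mul_self_eq_one_iff.1 (shiftSign_mul_self i)

lemma single_vecMul_signedShift (i : Fin (l + 1)) :
    Pi.single i 1 ᵥ* (signedShift l K).1 = Pi.single (i + 1) (shiftSign l K i) := by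
  ext j
  simp [signedShift_apply, Pi.single_apply]

lemma transvection_mul_signedShift {i j : Fin (l + 1)} (h : i ≠ j) (h' : i + 1 ≠ j + 1) (a : K) :
    SpecialLinearGroup.transvection h a * signedShift l K =
      signedShift l K *
        SpecialLinearGroup.transvection h' (shiftSign l K i * shiftSign l K j * a) := by
  apply Subtype.ext
  simp only [coe_mul, transvection_coe, mul_add, add_mul, one_mul, mul_one]
  congr 1
  ext x y
  have hsq := shiftSign_mul_self (K := K) i
  rw [Matrix.mul_apply, Matrix.mul_apply, Finset.sum_eq_single j, Finset.sum_eq_single (i + 1)]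
  · simp only [signedShift_apply, Matrix.single_apply]
    grind
  · intro m _ hm
    simp [hm.symm]
  · simp
  · intro m _ hm
    simp [hm.symm]
  · simp

lemma transvection_mem_of_signedShift_mem
    {H : Subgroup (SpecialLinearGroup (Fin (l + 1)) K)} (hB : signedShift l K ∈ H) {a : K}
    (h0 : ∀ h : Fin.last l ≠ 0, SpecialLinearGroup.transvection h a ∈ H)
    (i : Fin (l + 1)) (h : i ≠ i + 1) : SpecialLinearGroup.transvection h a ∈ H := by
  revert h
  induction i using fin_cyclic_induction (i₀ := Fin.last l) with
  | base =>
    rw [Fin.last_add_one]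
    exact h0
  | step m ih =>
    intro h
    have hne : m ≠ m + 1 := fun h' ↦ h (congrArg (· + 1) h')
    have hmem := ih hne
    have key := transvection_mul_signedShift hne h a
    rw [← inv_mul_eq_iff_eq_mul] at key
    have hconj := H.mul_mem (H.inv_mem hB) (H.mul_mem hmem hB)
    rw [key] at hconj
    rcases shiftSign_eq_or (K := K) m with h1 | h1 <;>
      rcases shiftSign_eq_or (K := K) (m + 1) with h2 | h2 <;>
      simp only [h1, h2, one_mul, mul_one, neg_mul, neg_neg] at hconj
    · exact hconj
    · rw [← transvection_inv] at hconj; exact H.inv_mem_iff.1 hconj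
    · rw [← transvection_inv] at hconj; exact H.inv_mem_iff.1 hconj
    · exact hconj

end SignedShift

section RowFiber

variable {l : ℕ} {K : Type*} [Field K]

/-- The set of matrices in `SL(l+1, K)` whose first row is `v`. -/
def rowFiber (v : Fin (l + 1) → K) : Set (SpecialLinearGroup (Fin (l + 1)) K) :=
  {g | g.1 0 = v}

lemma mul_mem_rowFiber {v : Fin (l + 1) → K} {g : SpecialLinearGroup (Fin (l + 1)) K}
    (t : SpecialLinearGroup (Fin (l + 1)) K) (hg : g ∈ rowFiber v) :
    g * t ∈ rowFiber (v ᵥ* t.1) := by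
  change (g.1 * t.1) 0 = _
  rw [← show g.1 0 = v from hg]
  rfl

lemma mul_inv_mem_rowFiber {v : Fin (l + 1) → K} {g : SpecialLinearGroup (Fin (l + 1)) K}
    (t : SpecialLinearGroup (Fin (l + 1)) K) (hg : g ∈ rowFiber (v ᵥ* t.1)) :
    g * t⁻¹ ∈ rowFiber v := by
  have := mul_mem_rowFiber t⁻¹ hg
  rwa [vecMul_vecMul, ← coe_mul, mul_inv_cancel, coe_one, vecMul_one] at this

lemma ncard_rowFiber_vecMul (v : Fin (l + 1) → K) (t : SpecialLinearGroup (Fin (l + 1)) K) :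
    (rowFiber (v ᵥ* t.1)).ncard = (rowFiber v).ncard := by
  rw [← Set.ncard_image_of_injective (rowFiber v) (mul_left_injective t)]
  congr 1
  ext g
  refine ⟨fun hg ↦ ⟨g * t⁻¹, mul_inv_mem_rowFiber t hg, by simp⟩, ?_⟩
  rintro ⟨x, hx, rfl⟩
  exact mul_mem_rowFiber t hx

lemma shiftSign_castSucc (i : Fin l) : shiftSign l K i.castSucc = 1 := by
  simp [shiftSign, Fin.castSucc_ne_last]

lemma castSucc_vecMul_signedShift (i : Fin l) :
    Pi.single i.castSucc 1 ᵥ* (signedShift l K).1 = Pi.single i.succ 1 := by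
  rw [single_vecMul_signedShift, shiftSign_castSucc, Fin.coeSucc_eq_succ]

lemma last_vecMul_signedShift :
    Pi.single (Fin.last l) ((-1) ^ l) ᵥ* (signedShift l K).1 = Pi.single 0 1 := by
  have : (Pi.single (Fin.last l) ((-1) ^ l) : Fin (l + 1) → K) =
      ((-1) ^ l : K) • Pi.single (Fin.last l) 1 := by
    rw [← Pi.single_smul]; simp
  rw [this, smul_vecMul, single_vecMul_signedShift, ← Pi.single_smul, Fin.last_add_one]
  simp [shiftSign, ← mul_pow]

lemma ncard_rowFiber_single (i : Fin (l + 1)) :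
    (rowFiber (Pi.single i (1 : K))).ncard =
      (rowFiber (Pi.single (0 : Fin (l + 1)) (1 : K))).ncard := by
  induction i using Fin.induction with
  | zero => rfl
  | succ i ih => rw [← castSucc_vecMul_signedShift, ncard_rowFiber_vecMul, ih]

variable (l K) in
/-- The matrices in `SL(l+1, K)` whose first row is one of `e_0, …, e_{l-1}`. -/
def unitRowSet : Set (SpecialLinearGroup (Fin (l + 1)) K) :=
  ⋃ i : Fin l, rowFiber (Pi.single i.castSucc 1)

lemma mem_unitRowSet {g : SpecialLinearGroup (Fin (l + 1)) K} :
    g ∈ unitRowSet l K ↔ ∃ i : Fin l, g ∈ rowFiber (Pi.single i.castSucc 1) :=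
  Set.mem_iUnion

lemma disjoint_rowFiber {v w : Fin (l + 1) → K} (h : v ≠ w) :
    Disjoint (rowFiber v) (rowFiber w) :=
  Set.disjoint_left.2 fun _ hv hw ↦ h (hv.symm.trans hw)

lemma mul_transvection_mem_unitRowSet {s : SpecialLinearGroup (Fin (l + 1)) K}
    (hs : s ∈ unitRowSet l K) (h : Fin.last l ≠ 0) (a : K) :
    s * SpecialLinearGroup.transvection h a ∈ unitRowSet l K := by
  obtain ⟨i, hi⟩ := mem_unitRowSet.1 hs
  refine mem_unitRowSet.2 ⟨i, ?_⟩
  have := mul_mem_rowFiber (SpecialLinearGroup.transvection h a) hi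
  convert this using 2
  rw [transvection_coe, vecMul_add, vecMul_one, left_eq_add]
  ext j
  simp [(Fin.castSucc_ne_last i).symm]

lemma mul_signedShift_mem {s : SpecialLinearGroup (Fin (l + 1)) K} (hs : s ∈ unitRowSet l K) :
    s * signedShift l K ∈ unitRowSet l K ∪ rowFiber (Pi.single (Fin.last l) 1) := by
  obtain ⟨i, hi⟩ := mem_unitRowSet.1 hs
  have := mul_mem_rowFiber (signedShift l K) hi
  rw [castSucc_vecMul_signedShift] at this
  rcases Fin.eq_castSucc_or_eq_last i.succ with ⟨j, hj⟩ | hj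
  · exact .inl (mem_unitRowSet.2 ⟨j, hj ▸ this⟩)
  · exact .inr (hj ▸ this)

lemma mul_signedShift_inv_mem {s : SpecialLinearGroup (Fin (l + 1)) K}
    (hs : s ∈ unitRowSet l K) :
    s * (signedShift l K)⁻¹ ∈ unitRowSet l K ∪ rowFiber (Pi.single (Fin.last l) ((-1) ^ l)) := by
  obtain ⟨i, hi⟩ := mem_unitRowSet.1 hs
  rcases Fin.eq_zero_or_eq_succ i.castSucc with h0 | ⟨j, hj⟩
  · rw [h0, ← last_vecMul_signedShift] at hi
    exact .inr (mul_inv_mem_rowFiber _ hi)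
  · rw [hj, ← castSucc_vecMul_signedShift] at hi
    exact .inl (mem_unitRowSet.2 ⟨j, mul_inv_mem_rowFiber _ hi⟩)

variable (l K) in
/-- The unipotent matrix adding `e_l` to each `e_i` with `i < l`. -/
def addLastColumn : SpecialLinearGroup (Fin (l + 1)) K :=
  ⟨of fun i j ↦ if i = j ∨ j = Fin.last l then 1 else 0, by
    rw [det_of_isUpperTriangular]
    · simp
    · intro i j hij
      simp only [id] at hij
      simp [hij.ne', (hij.trans_le (Fin.le_last i)).ne]⟩

variable [Finite K]

lemma ncard_unitRowSet :
    (unitRowSet l K).ncard = l * (rowFiber (Pi.single (0 : Fin (l + 1)) (1 : K))).ncard := by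
  rw [unitRowSet, Set.ncard_iUnion_of_finite]
  · rw [finsum_eq_sum_of_fintype]
    simp [ncard_rowFiber_single]
  · exact fun _ ↦ Set.toFinite _
  · intro i j hij
    refine disjoint_rowFiber fun h ↦ hij ?_
    simpa [Pi.single_apply] using congrFun h i.castSucc

lemma two_mul_ncard_unitRowSet_le :
    2 * (unitRowSet l K).ncard ≤ Nat.card (SpecialLinearGroup (Fin (l + 1)) K) := by
  rw [two_mul]
  nth_rw 2 [← Set.ncard_image_of_injective _ (mul_left_injective (addLastColumn l K))]
  rw [← Set.ncard_union_eq, ← Set.ncard_univ]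
  · exact Set.ncard_le_ncard (Set.subset_univ _)
  rw [Set.disjoint_right]
  rintro _ ⟨s, hs, rfl⟩ hs'
  obtain ⟨i, hi⟩ := mem_unitRowSet.1 hs
  obtain ⟨j, hj⟩ := mem_unitRowSet.1 hs'
  have := congrFun (hj.symm.trans (mul_mem_rowFiber (addLastColumn l K) hi)) (Fin.last l)
  simp [addLastColumn, Fin.castSucc_ne_last] at this

end RowFiber

/-- For `l ≥ 5` and any finite field `F = GF(q)`, there is a symmetric generating set `T`
of `SL(l+1, q)` of size at most `6` and a set `S` of vertices of `Cay(SL(l+1,q), T)` with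
`0 < |S| ≤ |SL(l+1,q)|/2` and `|∂S| / |S| ≤ 6 / l`; consequently the isoperimetric number
`h(Cay(SL(l+1,q), T)) = min {|∂S'|/|S'| : 0 < |S'| ≤ |G|/2}` is at most `6 / l`.
Here `∂S` is the set of vertices outside `S` adjacent to `S`, with `x ~ y` iff
`x⁻¹ y ∈ T`. -/
theorem stmt_19 {F : Type*} [Field F] [Fintype F] (l : ℕ) (hl : 5 ≤ l) :
    ∃ T : Set (Matrix.SpecialLinearGroup (Fin (l + 1)) F),
      T⁻¹ = T ∧ Subgroup.closure T = ⊤ ∧ T.ncard ≤ 6 ∧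
      (∃ S : Set (Matrix.SpecialLinearGroup (Fin (l + 1)) F),
        0 < S.ncard ∧
        2 * S.ncard ≤ Nat.card (Matrix.SpecialLinearGroup (Fin (l + 1)) F) ∧
        (({x | x ∉ S ∧ ∃ s ∈ S, s⁻¹ * x ∈ T}).ncard : ℝ) / S.ncard ≤ 6 / l) ∧
      sInf {ρ : ℝ | ∃ S : Set (Matrix.SpecialLinearGroup (Fin (l + 1)) F),
        0 < S.ncard ∧
        2 * S.ncard ≤ Nat.card (Matrix.SpecialLinearGroup (Fin (l + 1)) F) ∧
        ρ = (({x | x ∉ S ∧ ∃ s ∈ S, s⁻¹ * x ∈ T}).ncard : ℝ) / S.ncard} ≤ 6 / l := by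
  classical
  have hlast : Fin.last l ≠ 0 := Fin.last_eq_zero_iff.not.2 (by omega)
  obtain ⟨u, hu⟩ := IsCyclic.exists_monoid_generator (α := Fˣ)
  let A := SpecialLinearGroup.transvection hlast (1 : F)
  let C := SpecialLinearGroup.transvection hlast (u : F)
  let B := signedShift l F
  let T : Set (SpecialLinearGroup (Fin (l + 1)) F) := {A, A⁻¹, B, B⁻¹, C, C⁻¹}
  let N := (rowFiber (Pi.single (0 : Fin (l + 1)) (1 : F))).ncard
  have hN : 0 < N := (Set.ncard_pos (Set.toFinite _)).2
    ⟨1, show (1 : Matrix (Fin (l + 1)) (Fin (l + 1)) F) 0 = _ by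
      ext j; simp [one_apply, Pi.single_apply, eq_comm]⟩
  have hS : (unitRowSet l F).ncard = l * N := ncard_unitRowSet
  have hSpos : 0 < (unitRowSet l F).ncard := hS ▸ Nat.mul_pos (by omega) hN
  have hratio : (({x | x ∉ unitRowSet l F ∧ ∃ s ∈ unitRowSet l F, s⁻¹ * x ∈ T}).ncard : ℝ) /
      (unitRowSet l F).ncard ≤ 6 / l := by
    have hsub : {x | x ∉ unitRowSet l F ∧ ∃ s ∈ unitRowSet l F, s⁻¹ * x ∈ T} ⊆
        rowFiber (Pi.single (Fin.last l) 1) ∪ rowFiber (Pi.single (Fin.last l) ((-1) ^ l)) := by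
      rintro x ⟨hx, s, hs, ht⟩
      simp only [T, Set.mem_insert_iff, Set.mem_singleton_iff, inv_mul_eq_iff_eq_mul, A, C,
        transvection_inv] at ht
      rcases ht with rfl | rfl | rfl | rfl | rfl | rfl
      · exact absurd (mul_transvection_mem_unitRowSet hs _ _) hx
      · exact absurd (mul_transvection_mem_unitRowSet hs _ _) hx
      · exact .inl ((mul_signedShift_mem hs).resolve_left hx)
      · exact .inr ((mul_signedShift_inv_mem hs).resolve_left hx)
      · exact absurd (mul_transvection_mem_unitRowSet hs _ _) hx
      · exact absurd (mul_transvection_mem_unitRowSet hs _ _) hx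
    have hle : ({x | x ∉ unitRowSet l F ∧ ∃ s ∈ unitRowSet l F, s⁻¹ * x ∈ T}).ncard ≤ 2 * N := by
      refine (Set.ncard_le_ncard hsub).trans ((Set.ncard_union_le _ _).trans ?_)
      rw [ncard_rowFiber_single, ← ncard_rowFiber_vecMul (Pi.single (Fin.last l) ((-1) ^ l))
        (signedShift l F), last_vecMul_signedShift, two_mul]
    have hl0 : (0 : ℝ) < l := by exact_mod_cast (by omega : 0 < l)
    have hN0 : (0 : ℝ) < N := by exact_mod_cast hN
    have hle' : (({x | x ∉ unitRowSet l F ∧ ∃ s ∈ unitRowSet l F, s⁻¹ * x ∈ T}).ncard : ℝ) ≤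
        2 * N := by exact_mod_cast hle
    rw [hS, Nat.cast_mul, div_le_div_iff₀ (by positivity) hl0]
    nlinarith [mul_le_mul_of_nonneg_right hle' hl0.le, mul_pos hl0 hN0]
  refine ⟨T, ?_, ?_, ?_,
    ⟨unitRowSet l F, hSpos, two_mul_ncard_unitRowSet_le, hratio⟩,
    le_trans (csInf_le ⟨0, ?_⟩ ⟨unitRowSet l F, hSpos, two_mul_ncard_unitRowSet_le, rfl⟩) hratio⟩
  · ext x
    simp only [T, Set.mem_inv, Set.mem_insert_iff, Set.mem_singleton_iff, inv_eq_iff_eq_inv,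
      inv_inv]
    tauto
  · have hT (x) (hx : x ∈ T) : x ∈ Subgroup.closure T := Subgroup.subset_closure hx
    have hB : signedShift l F ∈ Subgroup.closure T := hT _ (by simp [T, B])
    refine eq_top_of_cyclic_transvection_mem (by omega) (g := (u : F)) (fun x hx ↦ ?_)
      (transvection_mem_of_signedShift_mem hB fun _ ↦ hT _ (by simp [T, A]))
      (transvection_mem_of_signedShift_mem hB fun _ ↦ hT _ (by simp [T, C]))
    obtain ⟨k, hk⟩ := hu (Units.mk0 x hx)
    exact ⟨k, by simpa using congrArg Units.val hk⟩
  · have : T = (({A, A⁻¹, B, B⁻¹, C, C⁻¹} : Finset _) : Set _) := by simp [T]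
    rw [this, Set.ncard_coe_finset]
    exact Finset.card_le_six
  · rintro _ ⟨S, -, -, rfl⟩
    positivity
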